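/- Let $N$ be a positive integer or $N=\infty$. A marked grid of size $N$ is an array $M(j,k)\in\{0,1\}$, defined for integers $j,k\ge 0$ with $j+k\le N$, such that: (M0) $M(n,0)=M(0,n)=1$ for every integer $0\le n\le N$; (M1) if $M(j,k)=1$, then $M(l,k)=1$ for all $0\le l\le j$; (M2) if $M(j,k)=1$, then $M(j-i,k+i)=M(j-i,i)$ for all $0\le i\le j$; (M3) if $j+k<N$, $1\le m\le j$, $M(j,k)=1$, $M(j+1,k)=0$, $M(j-i,i)=0$ for all $0<i<m$, and $M(j-m+1,m)=1$, then $M(j-m+1,k+m)=0$; (M4) if $j+k<N$, $M(j,k)=1$, $M(1,j)=0$, $M(j+1,k)=0$, and $M(j-i,k+i)=0$ for all $0<i<j$, then $M(1,j+k)=1$. Let $M$ be a marked grid of size $N$. For every integer $n$ with $1\le n\le N$ put $$\tau(n)=\max\{\,j : 0\le j<n,\ M(j,n-j)=1\,\}$$ (the maximum exists since $M(0,n)=1$), and put $\tau(0)=0$. Then: (A) $\tau(1)=0$; (B) $\tau(n+1)\le\tau(n)+1$ for all $n\ge 1$ with $n+1\le N$. Consequently $\tau(n)<n$ for all $1\le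 n\le N$, and for such $n$ we let $\operatorname{ord}(n)\ge 1$ be the least integer $m$ with $\tau^{m}(n)=0$, where $\tau^m$ is the $m$-th iterate. Moreover, for all $n\ge 1$ with $n+1\le N$: (C) for every $0<k<\operatorname{ord}(n)$: if $\tau(n+1)<\tau^k(n)+1$, then $\tau(n+1)\le\tau^{k+1}(n)+1$; (D) for every $0<k<\operatorname{ord}(n)$: if $\tau(n+1)<\tau^k(n)+1$ and $\tau(\tau^k(n)+1)=\tau^{k+1}(n)+1$, then $\tau(n+1)<\tau^{k+1}(n)+1$; (E) if $\operatorname{ord}(n)>1$ and $\operatorname{ord}(\tau^{\operatorname{ord}(n)-1}(n)+1)=1$, then $\tau(n+1)\ne 0$. -/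

import Mathlib

/-- A marked grid of size `N` (possibly `N = ∞`). The entry `M(j,k)` is `1` exactly when `M j k`
holds; only the entries with `j + k ≤ N` matter. -/
structure MarkedGrid (N : ℕ∞) (M : ℕ → ℕ → Prop) : Prop where
  /-- Rule (M0). -/
  m0 : ∀ n : ℕ, (n : ℕ∞) ≤ N → M n 0 ∧ M 0 n
  /-- Rule (M1). -/
  m1 : ∀ j k : ℕ, ((j + k : ℕ) : ℕ∞) ≤ N → M j k → ∀ l, l ≤ j → M l k
  /-- Rule (M2). -/
  m2 : ∀ j k : ℕ, ((j + k : ℕ) : ℕ∞) ≤ N → M j k →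
    ∀ i, i ≤ j → (M (j - i) (k + i) ↔ M (j - i) i)
  /-- Rule (M3). -/
  m3 : ∀ j k m : ℕ, ((j + k : ℕ) : ℕ∞) < N → 1 ≤ m → m ≤ j → M j k → ¬ M (j + 1) k →
    (∀ i, 0 < i → i < m → ¬ M (j - i) i) → M (j - m + 1) m → ¬ M (j - m + 1) (k + m)
  /-- Rule (M4). -/
  m4 : ∀ j k : ℕ, ((j + k : ℕ) : ℕ∞) < N → M j k → ¬ M 1 j → ¬ M (j + 1) k →
    (∀ i, 0 < i → i < j → ¬ M (j - i) (k + i)) → M 1 (j + k)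

/-- The τ-function of a marked grid: `τ_M(n) = max {j | 0 ≤ j < n, M(j, n - j) = 1}`.
At `n = 0` this is `sSup ∅ = 0`, the convention `τ(0) = 0`. -/
noncomputable def tauOfGrid (M : ℕ → ℕ → Prop) (n : ℕ) : ℕ :=
  sSup {j | j < n ∧ M j (n - j)}

/-- On `{1, …, N}` the supremum defining `τ_M(n)` is a maximum. -/
theorem tauOfGrid_isGreatest {N : ℕ∞} {M : ℕ → ℕ → Prop} (hM : MarkedGrid N M)
    {n : ℕ} (hn : 1 ≤ n) (hnN : (n : ℕ∞) ≤ N) :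
    IsGreatest {j | j < n ∧ M j (n - j)} (tauOfGrid M n) := by
  have hb : BddAbove {j | j < n ∧ M j (n - j)} := ⟨n, fun j hj => hj.1.le⟩
  have hne : {j | j < n ∧ M j (n - j)}.Nonempty := ⟨0, hn, (hM.m0 n hnN).2⟩
  exact ⟨Nat.sSup_mem hne hb, fun j hj => le_csSup hb hj⟩

/-- The order of `n ≥ 1` under `τ`: the least `m` with `τ^m(n) = 0`, so that `τ^j(n) > 0` for all
`0 ≤ j < m`. It exists whenever `τ` satisfies (A) and (B) and `n` is in the domain of `τ`. -/
noncomputable def ordOf (τ : ℕ → ℕ) (n : ℕ) : ℕ := sInf {m | τ^[m] n = 0}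

/-- Property (A): `τ(1) = 0`. -/
def PropA (τ : ℕ → ℕ) : Prop := τ 1 = 0

/-- Property (B): `τ(n+1) ≤ τ(n) + 1`, for all `n ≥ 1` with `n + 1 ≤ N`. -/
def PropB (N : ℕ∞) (τ : ℕ → ℕ) : Prop :=
  ∀ n : ℕ, 1 ≤ n → ((n + 1 : ℕ) : ℕ∞) ≤ N → τ (n + 1) ≤ τ n + 1

/-- Property (C): if `τ(n+1) < τ^k(n) + 1` for some `0 < k < ord(n)`, then
`τ(n+1) ≤ τ^{k+1}(n) + 1`. -/
def PropC (N : ℕ∞) (τ : ℕ → ℕ) : Prop :=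
  ∀ n : ℕ, 1 ≤ n → ((n + 1 : ℕ) : ℕ∞) ≤ N → ∀ k, 0 < k → k < ordOf τ n →
    τ (n + 1) < τ^[k] n + 1 → τ (n + 1) ≤ τ^[k + 1] n + 1

/-- Property (D): if `τ(n+1) < τ^k(n) + 1` for some `0 < k < ord(n)`, and
`τ(τ^k(n) + 1) = τ^{k+1}(n) + 1`, then `τ(n+1) < τ^{k+1}(n) + 1`. -/
def PropD (N : ℕ∞) (τ : ℕ → ℕ) : Prop :=
  ∀ n : ℕ, 1 ≤ n → ((n + 1 : ℕ) : ℕ∞) ≤ N → ∀ k, 0 < k → k < ordOf τ n →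
    τ (n + 1) < τ^[k] n + 1 → τ (τ^[k] n + 1) = τ^[k + 1] n + 1 →
      τ (n + 1) < τ^[k + 1] n + 1

/-- Property (E): if `ord(n) > 1` and `ord(τ^{ord(n)-1}(n) + 1) = 1`, then `τ(n+1) ≠ 0`. -/
def PropE (N : ℕ∞) (τ : ℕ → ℕ) : Prop :=
  ∀ n : ℕ, 1 ≤ n → ((n + 1 : ℕ) : ℕ∞) ≤ N → 1 < ordOf τ n →
    ordOf τ (τ^[ordOf τ n - 1] n + 1) = 1 → τ (n + 1) ≠ 0

theorem tauOfGrid_zero (M : ℕ → ℕ → Prop) : tauOfGrid M 0 = 0 := by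
  simp [tauOfGrid]

namespace MarkedGrid

variable {N : ℕ∞} {M : ℕ → ℕ → Prop}

theorem tau_lt (hM : MarkedGrid N M) {n : ℕ} (hn : 1 ≤ n) (hnN : (n : ℕ∞) ≤ N) :
    tauOfGrid M n < n :=
  (tauOfGrid_isGreatest hM hn hnN).1.1

theorem mark_tau (hM : MarkedGrid N M) {n : ℕ} (hn : 1 ≤ n) (hnN : (n : ℕ∞) ≤ N) :
    M (tauOfGrid M n) (n - tauOfGrid M n) :=
  (tauOfGrid_isGreatest hM hn hnN).1.2

theorem le_tau (hM : MarkedGrid N M) {n j : ℕ} (hnN : (n : ℕ∞) ≤ N) (hj : j < n)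
    (h : M j (n - j)) : j ≤ tauOfGrid M n :=
  (tauOfGrid_isGreatest hM (by omega) hnN).2 ⟨hj, h⟩

theorem tau_le (hM : MarkedGrid N M) {n : ℕ} (hnN : (n : ℕ∞) ≤ N) : tauOfGrid M n ≤ n := by
  rcases Nat.eq_zero_or_pos n with rfl | hn
  · exact (tauOfGrid_zero M).le
  · exact (hM.tau_lt hn hnN).le

/-- Below a mark `(j, n - j)`, the marks on the diagonals `n` and `j` lie in the same columns. -/
theorem mark_iff (hM : MarkedGrid N M) {n j a : ℕ} (hnN : (n : ℕ∞) ≤ N) (hj : j ≤ n)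
    (h : M j (n - j)) (ha : a ≤ j) : M a (n - a) ↔ M a (j - a) := by
  have := hM.m2 j (n - j) (by rwa [Nat.add_sub_cancel' hj]) h (j - a) (by omega)
  rwa [Nat.sub_sub_self ha, show n - j + (j - a) = n - a by omega] at this

/-- Every iterate of `τ` at `n` is a marked column of the diagonal `n`. -/
theorem iterate_mark (hM : MarkedGrid N M) {n : ℕ} (hnN : (n : ℕ∞) ≤ N) (k : ℕ) :
    (tauOfGrid M)^[k] n ≤ n ∧ M ((tauOfGrid M)^[k] n) (n - (tauOfGrid M)^[k] n) := by
  induction k with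
  | zero => simpa using (hM.m0 n hnN).1
  | succ k ih =>
    rw [Function.iterate_succ_apply']
    obtain ⟨hj, h⟩ := ih
    generalize (tauOfGrid M)^[k] n = j at hj h
    have hjN : (j : ℕ∞) ≤ N := le_trans (by exact_mod_cast hj) hnN
    have hle := hM.tau_le hjN
    refine ⟨hle.trans hj, ?_⟩
    rcases Nat.eq_zero_or_pos j with rfl | hpos
    · rwa [tauOfGrid_zero]
    · exact (hM.mark_iff hnN hj h hle).2 (hM.mark_tau hpos hjN)

/-- No marked column of the diagonal `n` lies strictly between consecutive iterates of `τ`. -/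
theorem le_iterate_succ (hM : MarkedGrid N M) {n a k : ℕ} (hnN : (n : ℕ∞) ≤ N)
    (ha : M a (n - a)) (hlt : a < (tauOfGrid M)^[k] n) : a ≤ (tauOfGrid M)^[k + 1] n := by
  rw [Function.iterate_succ_apply']
  obtain ⟨hj, h⟩ := hM.iterate_mark hnN k
  exact hM.le_tau (le_trans (by exact_mod_cast hj) hnN) hlt ((hM.mark_iff hnN hj h hlt.le).1 ha)

theorem iterate_lt (hM : MarkedGrid N M) {n k : ℕ} (hn : 1 ≤ n) (hnN : (n : ℕ∞) ≤ N)
    (hk : 0 < k) : (tauOfGrid M)^[k] n < n := by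
  obtain ⟨k, rfl⟩ := Nat.exists_eq_succ_of_ne_zero hk.ne'
  rw [Function.iterate_succ_apply']
  have hj := (hM.iterate_mark hnN k).1
  generalize (tauOfGrid M)^[k] n = j at hj
  rcases Nat.eq_zero_or_pos j with rfl | hpos
  · rw [tauOfGrid_zero]
    exact hn
  · exact (hM.tau_lt hpos (le_trans (by exact_mod_cast hj) hnN)).trans_le hj

/-- The column to the left of `τ (n + 1)` is marked on the diagonal `n`. -/
theorem mark_tau_succ_pred (hM : MarkedGrid N M) {n p : ℕ} (hnN : ((n + 1 : ℕ) : ℕ∞) ≤ N)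
    (hp : tauOfGrid M (n + 1) = p + 1) : p < n ∧ M p (n - p) := by
  have hlt := hM.tau_lt (Nat.le_add_left 1 n) hnN
  have hm := hM.mark_tau (Nat.le_add_left 1 n) hnN
  rw [hp] at hlt hm
  rw [Nat.add_sub_add_right] at hm
  exact ⟨by omega, hM.m1 (p + 1) (n - p) (by rwa [show p + 1 + (n - p) = n + 1 by omega]) hm p
    (Nat.le_succ p)⟩

theorem iterate_ne_zero_of_lt_ord {τ : ℕ → ℕ} {n k : ℕ} (hk : k < ordOf τ n) : τ^[k] n ≠ 0 :=
  fun h => Nat.notMem_of_lt_sInf hk h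

theorem iterate_ord {τ : ℕ → ℕ} {n : ℕ} (h : 0 < ordOf τ n) : τ^[ordOf τ n] n = 0 :=
  Nat.sInf_mem (Nat.nonempty_of_pos_sInf h)

theorem propA (hM : MarkedGrid N M) (hN : 1 ≤ N) : PropA (tauOfGrid M) :=
  Nat.lt_one_iff.1 (hM.tau_lt le_rfl (by exact_mod_cast hN))

theorem propB (hM : MarkedGrid N M) : PropB N (tauOfGrid M) := by
  intro n _ hnN
  rcases hp : tauOfGrid M (n + 1) with _ | p
  · exact Nat.zero_le _
  · obtain ⟨hlt, hm⟩ := hM.mark_tau_succ_pred hnN hp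
    exact Nat.succ_le_succ (hM.le_tau (le_trans (by exact_mod_cast n.le_succ) hnN) hlt hm)

theorem propC (hM : MarkedGrid N M) : PropC N (tauOfGrid M) := by
  intro n _ hnN k _ _ hlt
  rcases hp : tauOfGrid M (n + 1) with _ | p
  · exact Nat.zero_le _
  · obtain ⟨_, hm⟩ := hM.mark_tau_succ_pred hnN hp
    exact Nat.succ_le_succ
      (hM.le_iterate_succ (le_trans (by exact_mod_cast n.le_succ) hnN) hm (by omega))

/-- If `τ (n + 1) ≤ j < n`, the entry to the right of `(j, n - j)` is unmarked. -/
theorem not_mark_right (hM : MarkedGrid N M) {n j : ℕ} (hnN : ((n + 1 : ℕ) : ℕ∞) ≤ N)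
    (hj : j < n) (h : tauOfGrid M (n + 1) < j + 1) : ¬ M (j + 1) (n - j) := fun hm =>
  absurd (hM.le_tau (j := j + 1) hnN (by omega) (by rwa [Nat.add_sub_add_right])) (by omega)

theorem propD (hM : MarkedGrid N M) : PropD N (tauOfGrid M) := by
  intro n hn hnN k hk hko hlt heq
  refine lt_of_le_of_ne (hM.propC n hn hnN k hk hko hlt) fun hcon => ?_
  have hnN' : (n : ℕ∞) ≤ N := le_trans (by exact_mod_cast n.le_succ) hnN
  have hjn := hM.iterate_lt hn hnN' hk
  have hmj := (hM.iterate_mark hnN' k).2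
  have hj0 := iterate_ne_zero_of_lt_ord hko
  rw [Function.iterate_succ_apply'] at heq hcon
  generalize (tauOfGrid M)^[k] n = j at *
  have hjN : (j : ℕ∞) ≤ N := le_trans (by exact_mod_cast hjn.le) hnN'
  have hjN' : ((j + 1 : ℕ) : ℕ∞) ≤ N := le_trans (by exact_mod_cast hjn) hnN'
  have hpj := hM.tau_lt (Nat.pos_of_ne_zero hj0) hjN
  have hgap : ∀ a, a < j → M a (j - a) → a ≤ tauOfGrid M j := fun a => hM.le_tau hjN
  have h1 := hM.mark_tau (Nat.le_add_left 1 n) hnN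
  have h2 := hM.mark_tau (Nat.le_add_left 1 j) hjN'
  rw [hcon, Nat.add_sub_add_right] at h1
  rw [heq, Nat.add_sub_add_right] at h2
  generalize tauOfGrid M j = p at *
  have h3 := hM.m3 j (n - j) (j - p)
    (lt_of_lt_of_le (by exact_mod_cast (by omega : j + (n - j) < n + 1)) hnN)
    (by omega) (by omega) hmj (hM.not_mark_right hnN hjn hlt)
  rw [Nat.sub_sub_self hpj.le, show n - j + (j - p) = n - p by omega] at h3
  refine h3 (fun i hi him hm => ?_) h2 h1
  have := hgap (j - i) (by omega) (by rwa [Nat.sub_sub_self (by omega)])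
  omega

theorem propE (hM : MarkedGrid N M) : PropE N (tauOfGrid M) := by
  intro n hn hnN hord hord1 hcon
  have hnN' : (n : ℕ∞) ≤ N := le_trans (by exact_mod_cast n.le_succ) hnN
  have hzero := iterate_ord (hord1.symm ▸ Nat.one_pos)
  rw [hord1, Function.iterate_one] at hzero
  have hlast := iterate_ord (Nat.zero_lt_of_lt hord)
  rw [← Nat.sub_add_cancel hord.le, Function.iterate_succ_apply'] at hlast
  have hjn := hM.iterate_lt hn hnN' (Nat.sub_pos_of_lt hord)
  have hmj := (hM.iterate_mark hnN' (ordOf (tauOfGrid M) n - 1)).2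
  have hj0 := iterate_ne_zero_of_lt_ord (Nat.sub_one_lt_of_lt hord)
  generalize (tauOfGrid M)^[ordOf (tauOfGrid M) n - 1] n = j at *
  have hjN : (j : ℕ∞) ≤ N := le_trans (by exact_mod_cast hjn.le) hnN'
  have hjN' : ((j + 1 : ℕ) : ℕ∞) ≤ N := le_trans (by exact_mod_cast hjn) hnN'
  have h4 := hM.m4 j (n - j)
    (lt_of_lt_of_le (by exact_mod_cast (by omega : j + (n - j) < n + 1)) hnN) hmj
    (fun hm => absurd (hM.le_tau (j := 1) hjN' (by omega) (by simpa using hm)) (by omega))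
    (hM.not_mark_right hnN hjn (by omega))
    (fun i hi hij hm => by
      rw [show n - j + i = n - (j - i) by omega,
        hM.mark_iff hnN' hjn.le hmj (Nat.sub_le j i)] at hm
      have := hM.le_tau hjN (by omega) hm
      omega)
  rw [Nat.add_sub_cancel' hjn.le] at h4
  have := hM.le_tau (j := 1) hnN (by omega) (by simpa using h4)
  omega

end MarkedGrid

theorem tauOfGrid_admissible (N : ℕ∞) (hN : 1 ≤ N) (M : ℕ → ℕ → Prop)
    (hM : MarkedGrid N M) :
    PropA (tauOfGrid M) ∧ PropB N (tauOfGrid M) ∧ PropC N (tauOfGrid M) ∧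
      PropD N (tauOfGrid M) ∧ PropE N (tauOfGrid M) :=
  ⟨hM.propA hN, hM.propB, hM.propC, hM.propD, hM.propE⟩
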